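/- Let a, m be real numbers, n a natural number, and A a nonempty family of subsets of [n] = {1,...,n} with ∅ ∉ A. If ak + m ≠ 0 for all integers k with min_{A ∈ A} |A| ≤ k ≤ n, then ∑_{X ∈ U_n(A)} (a·|Z_A(X)| + m) · g_{a,m}(n, |X|) = 1. -/

import Mathlib

open Finset

def upSet (n : ℕ) (F : Finset (Finset (Fin n))) : Finset (Finset (Fin n)) :=
  univ.filter (fun X => ∃ A ∈ F, A ⊆ X)

def downSet (n : ℕ) (F : Finset (Finset (Fin n))) : Finset (Finset (Fin n)) :=
  univ.filter (fun X => ∃ A ∈ F, X ⊆ A)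

def zSet (n : ℕ) (F : Finset (Finset (Fin n))) (X : Finset (Fin n)) : Finset (Fin n) :=
  if X ∈ upSet n F then (F.filter (fun A => A ⊆ X)).inf id else ∅

def joinFam (n : ℕ) (F G : Finset (Finset (Fin n))) : Finset (Finset (Fin n)) :=
  (F ×ˢ G).image (fun p => p.1 ∪ p.2)

noncomputable def g (a m : ℝ) (n l : ℕ) : ℝ :=
  (Nat.factorial (n - l) : ℝ) * a ^ (n - l) / ∏ k ∈ Finset.Icc l n, (a * k + m)

lemma mem_upSet {n : ℕ} {F : Finset (Finset (Fin n))} {X : Finset (Fin n)} :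
    X ∈ upSet n F ↔ ∃ A ∈ F, A ⊆ X := by
  simp [upSet]

lemma upSet_mono {n : ℕ} {F : Finset (Finset (Fin n))} {X Y : Finset (Fin n)}
    (hX : X ∈ upSet n F) (h : X ⊆ Y) : Y ∈ upSet n F := by
  obtain ⟨A, hA, hAX⟩ := mem_upSet.1 hX
  exact mem_upSet.2 ⟨A, hA, hAX.trans h⟩

lemma zSet_eq_filter {n : ℕ} {F : Finset (Finset (Fin n))} {X : Finset (Fin n)}
    (hX : X ∈ upSet n F) : zSet n F X = {i ∈ X | X.erase i ∉ upSet n F} := by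
  ext i
  rw [zSet, if_pos hX, ← singleton_subset_iff, Finset.le_inf_iff]
  simp only [mem_filter, mem_upSet, id, singleton_subset_iff,
    subset_erase, and_imp, not_exists, not_and, not_not]
  obtain ⟨A, hA, hAX⟩ := mem_upSet.1 hX
  exact ⟨fun h => ⟨hAX (h A hA hAX), h⟩, fun h => h.2⟩

lemma card_zSet_add {n : ℕ} {F : Finset (Finset (Fin n))} {X : Finset (Fin n)}
    (hX : X ∈ upSet n F) :
    (zSet n F X).card + #{i ∈ X | X.erase i ∈ upSet n F} = X.card := by
  rw [zSet_eq_filter hX, add_comm, card_filter_add_card_filter_not]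

/-- Double counting of the pairs `Y ⊂ X = insert i Y` of members of an upset. -/
lemma sum_card_erase_mem_upSet (n : ℕ) (F : Finset (Finset (Fin n))) (f : ℕ → ℝ) :
    ∑ X ∈ upSet n F, (#{i ∈ X | X.erase i ∈ upSet n F} : ℝ) * f X.card =
      ∑ Y ∈ upSet n F, ((n - Y.card : ℕ) : ℝ) * f (Y.card + 1) := by
  have hcard (Y : Finset (Fin n)) : n - Y.card = Yᶜ.card := by
    rw [card_compl, Fintype.card_fin]
  simp_rw [hcard, ← nsmul_eq_mul, ← sum_const, sum_sigma']
  refine sum_bij' (fun p _ => ⟨p.1.erase p.2, p.2⟩) (fun p _ => ⟨insert p.2 p.1, p.2⟩)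
    ?_ ?_ ?_ ?_ ?_
  · rintro ⟨X, i⟩ h
    simp_all
  · rintro ⟨Y, i⟩ h
    simp only [mem_sigma, mem_compl] at h
    simp [h, upSet_mono h.1 (subset_insert i Y)]
  · rintro ⟨X, i⟩ h
    simp only [mem_sigma, mem_filter] at h
    simp [insert_erase h.2.1]
  · rintro ⟨Y, i⟩ h
    simp only [mem_sigma, mem_compl] at h
    simp [h.2]
  · rintro ⟨X, i⟩ h
    simp only [mem_sigma, mem_filter] at h
    rw [card_erase_add_one h.2.1]

lemma mul_g_self (a m : ℝ) {n : ℕ} (h : a * n + m ≠ 0) : (a * n + m) * g a m n n = 1 := by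
  simp [g, h]

lemma mul_g_eq_mul_g_succ (a m : ℝ) {n l : ℕ} (hl : l < n) (h : a * l + m ≠ 0) :
    (a * l + m) * g a m n l = ((n - l : ℕ) : ℝ) * (a * g a m n (l + 1)) := by
  obtain ⟨d, rfl⟩ := Nat.exists_eq_add_of_lt hl
  have h1 : l + d + 1 - l = d + 1 := by lia
  have h2 : l + d + 1 - (l + 1) = d := by lia
  rw [g, g, ← Finset.mul_prod_Ioc_eq_prod_Icc hl.le, h1, h2, Nat.factorial_succ, pow_succ,
    ← Finset.Icc_add_one_left_eq_Ioc, ← mul_div_assoc,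
    mul_div_mul_left _ _ h]
  push_cast
  ring

/-- Main theorem 1: the generalized AZ identity with weights a, m. -/
theorem generalized_az_identity (a m : ℝ) (n : ℕ)
    (F : Finset (Finset (Fin n))) (hF : F.Nonempty) (hne : ∅ ∉ F)
    (hk : ∀ k : ℕ, F.inf' hF Finset.card ≤ k → k ≤ n → a * k + m ≠ 0) :
    ∑ X ∈ upSet n F, (a * (zSet n F X).card + m) * g a m n X.card = 1 := by
  have hle (X : Finset (Fin n)) : X.card ≤ n := by simpa using card_le_univ X
  have hX0 (X) (hX : X ∈ upSet n F) : a * X.card + m ≠ 0 := by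
    obtain ⟨A, hA, hAX⟩ := mem_upSet.1 hX
    exact hk _ ((inf'_le _ hA).trans (card_le_card hAX)) (hle X)
  have huniv : univ ∈ upSet n F := hF.elim fun A hA => mem_upSet.2 ⟨A, hA, subset_univ A⟩
  have hsplit : ∀ X ∈ upSet n F, (a * (zSet n F X).card + m) * g a m n X.card =
      (a * X.card + m) * g a m n X.card -
        (#{i ∈ X | X.erase i ∈ upSet n F} : ℝ) * (a * g a m n X.card) := by
    intro X hX
    rw [← card_zSet_add hX]
    push_cast
    ring
  rw [sum_congr rfl hsplit, sum_sub_distrib,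
    sum_card_erase_mem_upSet n F (fun l => a * g a m n l), ← sum_sub_distrib,
    sum_eq_single_of_mem univ huniv]
  · have := hX0 univ huniv
    simp only [card_univ, Fintype.card_fin] at this ⊢
    simp [mul_g_self a m this]
  · intro X hX hXu
    have hlt : X.card < n := by
      simpa using card_lt_card (ssubset_univ_iff.2 hXu)
    rw [mul_g_eq_mul_g_succ a m hlt (hX0 X hX), sub_self]
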